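/- arXiv:math/9908107 — 2 statements merged into one kernel-verified Lean document; each statement's English description precedes it below -/
import Mathlib

section
/- Let R be a principal ideal domain and let A• and B• be bounded cochain complexes of R-modules with finitely generated cohomology modules. If every cohomology module H^k(A•) is a projective (equivalently, free) R-module, then there is an isomorphism of R-modules Hom_{D(R)}(A•, B•) ≅ ⊕_k Hom_R(H^k(A•), H^k(B•)), where Hom_{D(R)} denotes morphisms in the derived category. -/
/-!
STATEMENT 7: Let `R` be a PID, and let `A`, `B` be bounded cochain complexes of
`R`-modules with finitely generated cohomology.  If every cohomology module
`H^k(A)` is projective, then `Hom_{D(R)}(A, B) ≅ ⊕_k Hom_R (H^k(A), H^k(B))` as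
`R`-modules.  (The `R`-module structure on `Hom_{D(R)}(A, B)` is recorded by the
compatibility of the additive isomorphism with the action of `r : R` given by
composition with `Q.map (r • 𝟙 A)`.)
-/

open CategoryTheory Limits

universe u

namespace CochainComplex

section ZeroDifferential

variable {C : Type*} [Category* C] [Abelian C] {K L : CochainComplex C ℤ}

/-- The morphism of complexes given by maps to cycles, for a source with zero differential. -/
noncomputable def homOfCycles (hK : ∀ i j, K.d i j = 0) (α : ∀ k, K.X k ⟶ L.cycles k) :
    K ⟶ L where
  f k := α k ≫ L.iCycles k
  comm' i j _ := by simp [hK]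

/-- The isomorphism between the terms and the cohomology of a complex with zero differential. -/
noncomputable def toHomology (hK : ∀ i j, K.d i j = 0) (k : ℤ) : K.X k ⟶ K.homology k :=
  K.liftCycles (𝟙 _) (k + 1) (by simp) (by simp [hK]) ≫ K.homologyπ k

lemma toHomology_comp_homologyMap (hK : ∀ i j, K.d i j = 0) (φ : K ⟶ L) (k : ℤ) :
    toHomology hK k ≫ HomologicalComplex.homologyMap φ k =
      L.liftCycles (φ.f k) (k + 1) (by simp) (by simp [hK]) ≫ L.homologyπ k := by
  simp [toHomology]

lemma toHomology_comp_homologyMap_homOfCycles (hK : ∀ i j, K.d i j = 0)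
    (α : ∀ k, K.X k ⟶ L.cycles k) (k : ℤ) :
    toHomology hK k ≫ HomologicalComplex.homologyMap (homOfCycles hK α) k =
      α k ≫ L.homologyπ k := by
  rw [toHomology_comp_homologyMap]
  congr 1
  simp [← cancel_mono (L.iCycles k), homOfCycles]

lemma isIso_toHomology (hK : ∀ i j, K.d i j = 0) (k : ℤ) : IsIso (toHomology hK k) := by
  have hπ : IsIso (K.homologyπ k) := K.isIso_homologyπ (k - 1) k (by simp) (hK _ _)
  have hc : IsIso (K.liftCycles (𝟙 (K.X k)) (k + 1) (by simp) (by simp [hK])) :=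
    ⟨K.iCycles k, by simp, by simp [← cancel_mono (K.iCycles k)]⟩
  exact IsIso.comp_isIso

lemma nonempty_homotopy_zero_of_homologyMap_eq_zero (hK : ∀ i j, K.d i j = 0)
    [∀ k, Projective (K.X k)] (φ : K ⟶ L)
    (hφ : ∀ k, HomologicalComplex.homologyMap φ k = 0) : Nonempty (Homotopy φ 0) := by
  have lift (i j : ℤ) (hij : (ComplexShape.up ℤ).Rel j i) :
      ∃ h : K.X i ⟶ L.X j, h ≫ L.d j i = φ.f i := by
    have exact : (ShortComplex.mk _ _ (L.toCycles_comp_homologyπ j i)).Exact :=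
      ShortComplex.exact_of_g_is_cokernel _
        (L.homologyIsCokernel j i ((ComplexShape.up ℤ).prev_eq' hij))
    have zero := toHomology_comp_homologyMap hK φ i
    rw [hφ, comp_zero] at zero
    refine ⟨exact.liftFromProjective _ zero.symm, ?_⟩
    have comp_iCycles :=
      congrArg (fun f ↦ f ≫ L.iCycles i) (exact.liftFromProjective_comp _ zero.symm)
    simpa using comp_iCycles
  choose h hh using lift
  refine ⟨(Homotopy.ofEq ?_).trans (Homotopy.nullHomotopy' h)⟩
  ext i
  rw [Homotopy.nullHomotopicMap'_f (k₂ := i - 1) (k₀ := i + 1) (by simp) (by simp), hh, hK]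
  simp

end ZeroDifferential

end CochainComplex

namespace DerivedCategory

variable {C : Type*} [Category* C] [Abelian C] [HasDerivedCategory C]

/-- The cohomology in the derived category of the image of a complex is its cohomology. -/
noncomputable def homologyIso (A : CochainComplex C ℤ) (k : ℤ) :
    (homologyFunctor C k).obj (Q.obj A) ≅ A.homology k :=
  (homologyFunctorFactors C k).app A

/-- The action on cohomology of morphisms in the derived category, as an additive map. -/
noncomputable def homologyHom (A B : CochainComplex C ℤ) :
    (Q.obj A ⟶ Q.obj B) →+ ∀ k, A.homology k ⟶ B.homology k where
  toFun f k := (homologyIso A k).inv ≫ (homologyFunctor C k).map f ≫ (homologyIso B k).hom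
  map_zero' := by ext; simp
  map_add' f g := by ext; simp [Functor.map_add]

lemma homologyHom_apply (A B : CochainComplex C ℤ) (f : Q.obj A ⟶ Q.obj B) (k : ℤ) :
    homologyHom A B f k =
      (homologyIso A k).inv ≫ (homologyFunctor C k).map f ≫ (homologyIso B k).hom := rfl

lemma homologyHom_Q_map {A B : CochainComplex C ℤ} (φ : A ⟶ B) (k : ℤ) :
    homologyHom A B (Q.map φ) k = HomologicalComplex.homologyMap φ k := by
  rw [homologyHom_apply, Iso.inv_comp_eq]
  exact homologyFunctorFactors_hom_naturality φ k

lemma homologyHom_comp {A B D : CochainComplex C ℤ} (f : Q.obj A ⟶ Q.obj B)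
    (g : Q.obj B ⟶ Q.obj D) (k : ℤ) :
    homologyHom A D (f ≫ g) k = homologyHom A B f k ≫ homologyHom B D g k := by
  simp [homologyHom_apply]

lemma Q_map_surjective_of_isKProjective (K L : CochainComplex C ℤ) [K.IsKProjective] :
    Function.Surjective (Q.map : (K ⟶ L) → _) := by
  intro f
  obtain ⟨g, hg⟩ := (CochainComplex.IsKProjective.Qh_map_bijective K
    ((HomotopyCategory.quotient _ _).obj L)).surjective
      ((quotientCompQhIso C).hom.app K ≫ f ≫ (quotientCompQhIso C).inv.app L)
  obtain ⟨φ, rfl⟩ := (HomotopyCategory.quotient _ _).map_surjective g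
  refine ⟨φ, ?_⟩
  rw [← cancel_epi ((quotientCompQhIso C).hom.app K), ← quotientCompQhIso_hom_naturality, hg]
  simp

theorem homologyHom_bijective_of_projective (A B : CochainComplex C ℤ)
    [∀ k, Projective (A.homology k)] (b : ℤ) (hA : ∀ k, b < k → IsZero (A.homology k)) :
    Function.Bijective (homologyHom A B) := by
  let K : CochainComplex C ℤ := { X := fun k ↦ A.homology k, d := fun _ _ ↦ 0 }
  have hK (i j : ℤ) : K.d i j = 0 := rfl
  have (k : ℤ) : Projective (K.X k) := inferInstanceAs (Projective (A.homology k))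
  have : K.IsStrictlyLE b := (K.isStrictlyLE_iff b).2 hA
  have : K.IsKProjective := CochainComplex.isKProjective_of_projective K b
  let splitting (k : ℤ) : K.X k ⟶ A.cycles k :=
    Projective.factorThru (𝟙 (A.homology k)) (A.homologyπ k)
  have splitting_comp (k : ℤ) : splitting k ≫ A.homologyπ k = 𝟙 (A.homology k) :=
    Projective.factorThru_comp _ _
  let s : K ⟶ A := CochainComplex.homOfCycles hK splitting
  have hs (k : ℤ) : CochainComplex.toHomology hK k ≫ HomologicalComplex.homologyMap s k =
      𝟙 (A.homology k) :=
    (CochainComplex.toHomology_comp_homologyMap_homOfCycles hK splitting k).trans (splitting_comp k)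
  have isIso_s (k : ℤ) : IsIso (HomologicalComplex.homologyMap s k) := by
    have := CochainComplex.isIso_toHomology hK k
    have : IsIso (CochainComplex.toHomology hK k ≫ HomologicalComplex.homologyMap s k) := by
      rw [hs]
      exact IsIso.id _
    exact IsIso.of_isIso_comp_left (CochainComplex.toHomology hK k) _
  have : QuasiIso s := ⟨fun k ↦ (quasiIsoAt_iff_isIso_homologyMap s k).2 (isIso_s k)⟩
  refine ⟨(injective_iff_map_eq_zero _).2 fun f hf ↦ ?_, fun α ↦ ?_⟩
  · obtain ⟨φ, hφ⟩ := Q_map_surjective_of_isKProjective K B (Q.map s ≫ f)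
    have hφ₀ (k : ℤ) : HomologicalComplex.homologyMap φ k = 0 := by
      rw [← homologyHom_Q_map, hφ, homologyHom_comp, hf]
      simp
    obtain ⟨h⟩ := CochainComplex.nonempty_homotopy_zero_of_homologyMap_eq_zero hK φ hφ₀
    rw [← cancel_epi (Q.map s), ← hφ, Q_map_eq_of_homotopy C h, Q.map_zero, comp_zero]
  · let β (k : ℤ) : K.X k ⟶ B.cycles k := Projective.factorThru (α k) (B.homologyπ k)
    have hβ (k : ℤ) : β k ≫ B.homologyπ k = α k := Projective.factorThru_comp _ _
    let φ : K ⟶ B := CochainComplex.homOfCycles hK β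
    refine ⟨inv (Q.map s) ≫ Q.map φ, ?_⟩
    ext k
    have := CochainComplex.isIso_toHomology hK k
    rw [← cancel_epi (HomologicalComplex.homologyMap s k), ← homologyHom_Q_map s,
      ← homologyHom_comp, IsIso.hom_inv_id_assoc, homologyHom_Q_map, homologyHom_Q_map,
      ← cancel_epi (CochainComplex.toHomology hK k), reassoc_of% (hs k)]
    exact (CochainComplex.toHomology_comp_homologyMap_homOfCycles hK β k).trans
      ((hβ k).trans (Category.id_comp (α k)).symm)

end DerivedCategory

lemma HomologicalComplex.homologyMap_smul_id {R C ι : Type*} [Ring R] [Category* C] [Abelian C]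
    [Linear R C] {c : ComplexShape ι} (A : HomologicalComplex C c) (r : R) (k : ι) :
    homologyMap (r • 𝟙 A) k = r • 𝟙 (A.homology k) := by
  rw [← homologyMap_id]
  exact ShortComplex.homologyMap_smul ((shortComplexFunctor C c k).map (𝟙 A)) r

lemma DirectSum.coeFnLinearMap_bijective {R ι : Type*} [Semiring R] {M : ι → Type*}
    [∀ i, AddCommMonoid (M i)] [∀ i, Module R (M i)] (s : Finset ι)
    (h : ∀ i ∉ s, Subsingleton (M i)) :
    Function.Bijective (DirectSum.coeFnLinearMap R : DirectSum ι M →ₗ[R] ∀ i, M i) := by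
  classical
  refine ⟨DFunLike.coe_injective, fun x ↦ ⟨DirectSum.mk M s fun i ↦ x i, funext fun i ↦ ?_⟩⟩
  by_cases hi : i ∈ s
  · rw [DirectSum.coeFnLinearMap_apply, DirectSum.mk_apply_of_mem hi]
  · have := h i hi
    exact Subsingleton.elim _ _

theorem hom_derivedCategory_iso_directSum_hom_cohomology
    (R : Type u) [CommRing R] [IsDomain R] [IsPrincipalIdealRing R]
    [HasDerivedCategory (ModuleCat.{u} R)]
    (A B : CochainComplex (ModuleCat.{u} R) ℤ) (a b : ℤ)
    (hA : ∀ n : ℤ, n < a ∨ b < n → IsZero (A.X n))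
    (hB : ∀ n : ℤ, n < a ∨ b < n → IsZero (B.X n))
    (hfgA : ∀ k : ℤ, Module.Finite R (A.homology k))
    (hfgB : ∀ k : ℤ, Module.Finite R (B.homology k))
    (hproj : ∀ k : ℤ, Module.Projective R (A.homology k)) :
    ∃ e : (DerivedCategory.Q.obj A ⟶ DerivedCategory.Q.obj B) ≃+
        (DirectSum ℤ fun k => (A.homology k →ₗ[R] B.homology k)),
      ∀ (r : R) (f : DerivedCategory.Q.obj A ⟶ DerivedCategory.Q.obj B),
        e (DerivedCategory.Q.map (r • 𝟙 A) ≫ f) = r • e f := by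
  have isZero_homology (k : ℤ) (hk : k < a ∨ b < k) : IsZero (A.homology k) :=
    ShortComplex.isZero_homology_of_isZero_X₂ _ (hA k hk)
  have projective_homology (k : ℤ) : CategoryTheory.Projective (A.homology k) := by
    have := hproj k
    infer_instance
  let homologyEquiv := (AddEquiv.ofBijective (DerivedCategory.homologyHom A B)
    (DerivedCategory.homologyHom_bijective_of_projective A B b
      fun k hk ↦ isZero_homology k (Or.inr hk))).trans
    (AddEquiv.piCongrRight fun k ↦ ModuleCat.homAddEquiv)
  let directSumEquiv := LinearEquiv.ofBijective
    (DirectSum.coeFnLinearMap R (M := fun k ↦ A.homology k →ₗ[R] B.homology k))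
    (DirectSum.coeFnLinearMap_bijective (Finset.Icc a b) fun k hk ↦ by
      have : Subsingleton (A.homology k) :=
        ModuleCat.subsingleton_of_isZero (isZero_homology k (by
          rw [Finset.mem_Icc] at hk
          lia))
      infer_instance)
  refine ⟨homologyEquiv.trans directSumEquiv.symm.toAddEquiv, fun r f ↦ ?_⟩
  have hr : homologyEquiv (DerivedCategory.Q.map (r • 𝟙 A) ≫ f) = r • homologyEquiv f := by
    ext k : 1
    change (DerivedCategory.homologyHom A B _ k).hom =
      r • (DerivedCategory.homologyHom A B f k).hom
    rw [DerivedCategory.homologyHom_comp, DerivedCategory.homologyHom_Q_map,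
      HomologicalComplex.homologyMap_smul_id, Linear.smul_comp, Category.id_comp,
      ModuleCat.hom_smul]
  exact (congrArg directSumEquiv.symm hr).trans (directSumEquiv.symm.map_smul r _)
end

section
/- Let R be a principal ideal domain, let A• and B• be bounded cochain complexes of R-modules, and assume every term B^q is a flat R-module (so that the ordinary tensor product of complexes computes the derived tensor product). Then for every integer i there is an isomorphism of R-modules H^i(A• ⊗_R B•) ≅ (⊕_{p+q=i} H^p(A•) ⊗_R H^q(B•)) ⊕ (⊕_{r+s=i+1} Tor_1^R(H^r(A•), H^s(B•))). -/
/-!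
STATEMENT 8: (Künneth formula) Let `R` be a PID, `A`, `B` bounded cochain complexes
of `R`-modules with each `B^q` flat.  Then for every `i` there is an isomorphism
`H^i(A ⊗ B) ≅ (⊕_{p+q=i} H^p(A) ⊗ H^q(B)) ⊕ (⊕_{r+s=i+1} Tor_1(H^r(A), H^s(B)))`,
where `A ⊗ B` is the total tensor product complex.
-/

open CategoryTheory Limits MonoidalCategory

universe u

noncomputable instance (R : Type u) [CommRing R] :
    (curriedTensor (ModuleCat.{u} R)).Additive where
  map_add := by
    intros
    ext Z
    simp [curriedTensor, MonoidalPreadditive.add_whiskerRight]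

theorem Module.Baer.of_surjective_of_isPrincipalIdealRing {R : Type u} [CommRing R] [IsDomain R]
    [IsPrincipalIdealRing R] {J Q : Type u} [AddCommGroup J] [Module R J] [AddCommGroup Q]
    [Module R Q] (hJ : Module.Baer R J) (π : J →ₗ[R] Q) (hπ : Function.Surjective π) :
    Module.Baer R Q := by
  intro I g
  obtain ⟨r, rfl⟩ := (IsPrincipalIdealRing.principal I).principal
  have hr : r ∈ Submodule.span R {r} := Submodule.mem_span_singleton_self r
  obtain ⟨j, hj⟩ := hπ (g ⟨r, hr⟩)
  by_cases h0 : r = 0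
  · refine ⟨0, fun x hx ↦ ?_⟩
    obtain rfl : x = 0 := by simpa [h0] using hx
    exact (map_zero g).symm
  · let e := LinearEquiv.toSpanNonzeroSingleton R R r h0
    obtain ⟨k, hk⟩ := hJ _ ((LinearMap.toSpanSingleton R J j).comp e.symm.toLinearMap)
    have hkr : k r = j := by
      rw [hk r hr]
      have : e.symm ⟨r, hr⟩ = 1 := by
        rw [LinearEquiv.symm_apply_eq]
        ext
        simp [e]
      simp [this]
    refine ⟨π.comp k, fun x hx ↦ ?_⟩
    obtain ⟨c, rfl⟩ := Submodule.mem_span_singleton.1 hx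
    have : (⟨c • r, hx⟩ : Submodule.span R {r}) = c • ⟨r, hr⟩ := rfl
    rw [this, map_smul g, ← hj, map_smul, LinearMap.comp_apply, hkr]

theorem Module.Projective.of_injective_of_isPrincipalIdealRing {R : Type u} [CommRing R]
    [IsDomain R] [IsPrincipalIdealRing R] {K F : Type u} [AddCommGroup K] [Module R K]
    [AddCommGroup F] [Module R F] [Module.Projective R F] (i : K →ₗ[R] F)
    (hi : Function.Injective i) : Module.Projective R K := by
  refine Module.Projective.of_lifting_property'' fun π hπ ↦ ?_
  let J := Injective.under (ModuleCat.of R (K →₀ R))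
  let ι : (K →₀ R) →ₗ[R] J := (Injective.ι (ModuleCat.of R (K →₀ R))).hom
  have hι : Function.Injective ι := (ModuleCat.mono_iff_injective _).1 inferInstance
  have hJ : Module.Baer R J := Module.Baer.of_injective
    ((Module.injective_iff_injective_object R J).2
      (inferInstanceAs (CategoryTheory.Injective (Injective.under (ModuleCat.of R (K →₀ R))))))
  let N := (LinearMap.ker π).map ι
  have hQ := hJ.of_surjective_of_isPrincipalIdealRing N.mkQ N.mkQ_surjective
  let α : K →ₗ[R] J ⧸ N := ((LinearMap.ker π).mapQ N ι (Submodule.le_comap_map _ _)).comp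
    (π.quotKerEquivOfSurjective hπ).symm.toLinearMap
  have hα (e) : α (π e) = N.mkQ (ι e) := by
    have : (π.quotKerEquivOfSurjective hπ).symm (π e) = Submodule.Quotient.mk e := by
      rw [LinearEquiv.symm_apply_eq]
      rfl
    simp [α, this]
  obtain ⟨β, hβ⟩ := Module.Baer.extension_property hQ i hi α
  obtain ⟨g, hg⟩ := Module.projective_lifting_property N.mkQ β N.mkQ_surjective
  have key (k : K) : ∃ e, π e = k ∧ ι e = g (i k) := by
    obtain ⟨e, rfl⟩ := hπ k
    have h1 : N.mkQ (g (i (π e))) = N.mkQ (ι e) := by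
      rw [← hα, ← hβ, ← hg]
      rfl
    obtain ⟨n, hn, hn'⟩ := (Submodule.Quotient.eq N).1 h1
    refine ⟨n + e, ?_, ?_⟩
    · rw [map_add, LinearMap.mem_ker.1 hn, zero_add]
    · rw [map_add, hn', sub_add_cancel]
  refine ⟨(LinearEquiv.ofInjective ι hι).symm.toLinearMap.comp
    ((g.comp i).codRestrict (LinearMap.range ι) fun k ↦ ?_), ?_⟩
  · obtain ⟨e, -, he⟩ := key k
    exact ⟨e, he⟩
  · ext k
    obtain ⟨e, hek, he⟩ := key k
    simp only [LinearMap.comp_apply, LinearEquiv.coe_coe, LinearMap.id_apply]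
    rw [← hek]
    congr 1
    rw [LinearEquiv.symm_apply_eq]
    ext
    simp [he, hek]

theorem ModuleCat.projective_of_mono {R : Type u} [CommRing R]
    [IsDomain R] [IsPrincipalIdealRing R] {K F : ModuleCat.{u} R} (i : K ⟶ F) [Mono i]
    [Projective F] : Projective K := by
  have : Module.Projective R F := (IsProjective.iff_projective F).2 ‹_›
  have := Module.Projective.of_injective_of_isPrincipalIdealRing i.hom
    ((ModuleCat.mono_iff_injective i).1 inferInstance)
  exact (IsProjective.iff_projective K).1 this

namespace HomologicalComplex

section Double

variable {C : Type*} [Category* C] [Abelian C] {ι : Type*} {c : ComplexShape ι} {i₀ i₁ : ι}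
  (hi : c.Rel i₀ i₁)

theorem isIso_homologyMap_double (h : i₀ ≠ i₁) {X₀ X₁ M : C} {f : X₀ ⟶ X₁} {g : X₁ ⟶ M}
    {w : f ≫ g = 0} (hS : (ShortComplex.mk f g w).Exact) [Epi g] {K : HomologicalComplex C c}
    (φ : double f hi ⟶ K) (γ : X₁ ⟶ K.cycles i₁)
    (hγ : γ ≫ K.iCycles i₁ = (doubleXIso₁ f hi h).inv ≫ φ.f i₁)
    (e : M ≅ K.homology i₁) (comm : γ ≫ K.homologyπ i₁ = g ≫ e.hom) :
    IsIso (homologyMap φ i₁) := by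
  have hd : (double f hi).d i₁ (c.next i₁) = 0 := double_d_eq_zero₀ _ _ _ _ h.symm
  have hiso : IsIso ((double f hi).iCycles i₁) := isIso_iCycles _ i₁ _ rfl hd
  let p : X₁ ⟶ (double f hi).homology i₁ :=
    (doubleXIso₁ f hi h).inv ≫ inv ((double f hi).iCycles i₁) ≫ (double f hi).homologyπ i₁
  have hp : Epi p := inferInstance
  have hfp : f ≫ p = 0 := by
    have : (doubleXIso₀ f hi).hom ≫ f ≫ p = 0 := by
      rw [← (double f hi).toCycles_comp_homologyπ i₀ i₁]
      have h1 : (double f hi).toCycles i₀ i₁ =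
          (double f hi).d i₀ i₁ ≫ inv ((double f hi).iCycles i₁) := by
        rw [IsIso.eq_comp_inv, toCycles_i]
      rw [h1, double_d _ _ h]
      simp [p]
    rwa [← cancel_epi (doubleXIso₀ f hi).hom, comp_zero]
  have hpφ : p ≫ homologyMap φ i₁ = g ≫ e.hom := by
    rw [← comm]
    simp only [p, Category.assoc, homologyπ_naturality]
    rw [← Category.assoc, ← Category.assoc]
    congr 1
    rw [← cancel_mono (K.iCycles i₁), hγ]
    simp
  have : Epi (ShortComplex.mk f g w).g := ‹Epi g›
  let s : M ⟶ (double f hi).homology i₁ := hS.desc p hfp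
  have hs : g ≫ s = p := hS.g_desc p hfp
  refine ⟨e.inv ≫ s, ?_, ?_⟩
  · rw [← cancel_epi p, reassoc_of% hpφ, e.hom_inv_id_assoc, hs, Category.comp_id]
  · rw [Category.assoc, Iso.inv_comp_eq, Category.comp_id, ← cancel_epi g, reassoc_of% hs, hpφ]

theorem double_exactAt (h : i₀ ≠ i₁) {X₀ X₁ : C} (f : X₀ ⟶ X₁) [Mono f] (n : ι) (hn : n ≠ i₁) :
    (double f hi).ExactAt n := by
  by_cases h0 : n = i₀
  · subst h0
    rw [exactAt_iff' _ (c.prev n) n i₁ rfl (c.next_eq' hi),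
      ShortComplex.exact_iff_mono _ (double_d_eq_zero₁ f hi _ _ h)]
    change Mono ((double f hi).d n i₁)
    rw [double_d _ _ h]
    infer_instance
  · exact ShortComplex.exact_of_isZero_X₂ _ (isZero_double_X f hi n h0 hn)

/-- The morphism from a two-term complex to a complex concentrated in a single degree
that is induced by a morphism from the last term. -/
noncomputable def doubleToSingle [DecidableEq ι] (h : i₀ ≠ i₁) {X₀ X₁ M : C} (f : X₀ ⟶ X₁)
    (g : X₁ ⟶ M) (w : f ≫ g = 0) : double f hi ⟶ (single C c i₁).obj M :=
  mkHomToSingle ((doubleXIso₁ f hi h).hom ≫ g) fun i hi' ↦ by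
    obtain rfl := c.prev_eq hi' hi
    simp [double_d _ _ h, w]

theorem quasiIso_doubleToSingle [DecidableEq ι] (h : i₀ ≠ i₁) {X₀ X₁ M : C} {f : X₀ ⟶ X₁}
    {g : X₁ ⟶ M} {w : f ≫ g = 0} (hS : (ShortComplex.mk f g w).ShortExact) :
    QuasiIso (doubleToSingle hi h f g w) := by
  have := hS.mono_f
  have := hS.epi_g
  dsimp at *
  refine ⟨fun n ↦ ?_⟩
  by_cases hn : n = i₁
  · subst hn
    rw [quasiIsoAt_iff_isIso_homologyMap]
    refine isIso_homologyMap_double hi h hS.exact _ (g ≫ (singleObjCyclesSelfIso c n M).inv) ?_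
      (singleObjHomologySelfIso c n M).symm ?_
    · simp [doubleToSingle]
    · simp
  · rw [quasiIsoAt_iff_exactAt _ _ (double_exactAt hi h f n hn)]
    exact exactAt_single_obj c i₁ M n hn

theorem projective_double_X {X₀ X₁ : C} (f : X₀ ⟶ X₁) [Projective X₀] [Projective X₁] (n : ι) :
    Projective ((double f hi).X n) := by
  dsimp [double]
  split_ifs <;> infer_instance

theorem exists_double_hom [EnoughProjectives C]
    (hproj : ∀ {X P : C} (i : X ⟶ P) [Mono i] [Projective P], Projective X)
    (h : i₀ ≠ i₁) (K : HomologicalComplex C c) :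
    ∃ (X₀ X₁ : C) (f : X₀ ⟶ X₁) (g : X₁ ⟶ K.homology i₁) (w : f ≫ g = 0),
      (ShortComplex.mk f g w).ShortExact ∧ Projective X₀ ∧ Projective X₁ ∧
        ∃ φ : double f hi ⟶ K, IsIso (homologyMap φ i₁) := by
  obtain ⟨X₁, hX₁, γ, hγ⟩ : ∃ (X₁ : C) (_ : Projective X₁) (γ : X₁ ⟶ K.cycles i₁), Epi γ :=
    ⟨_, Projective.projective_over _, Projective.π _, inferInstance⟩
  let g : X₁ ⟶ K.homology i₁ := γ ≫ K.homologyπ i₁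
  let f := kernel.ι g
  have hX₀ : Projective (kernel g) := hproj f
  have hK : (ShortComplex.mk (K.toCycles i₀ i₁) (K.homologyπ i₁)
      (K.toCycles_comp_homologyπ i₀ i₁)).Exact :=
    ShortComplex.exact_of_g_is_cokernel _ (K.homologyIsCokernel i₀ i₁ (c.prev_eq' hi))
  have hfγ : (f ≫ γ) ≫ K.homologyπ i₁ = 0 := by
    rw [Category.assoc]
    exact kernel.condition g
  have hE : (ShortComplex.mk f g (kernel.condition g)).Exact := ShortComplex.exact_kernel g
  let φ : double f hi ⟶ K := mkHomFromDouble hi h (hK.liftFromProjective (f ≫ γ) hfγ)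
    (γ ≫ K.iCycles i₁) (by
      have := hK.liftFromProjective_comp (f ≫ γ) hfγ
      dsimp at this
      rw [← K.toCycles_i, reassoc_of% this]) (by simp)
  refine ⟨_, X₁, f, g, kernel.condition g, ?_, hX₀, hX₁, φ, ?_⟩
  · exact { exact := hE, mono_f := by dsimp; infer_instance, epi_g := by dsimp; infer_instance }
  · exact isIso_homologyMap_double hi h hE φ γ (by simp [φ]) (Iso.refl _) (by simp [g])

end Double

end HomologicalComplex

section Bifunctor

open HomologicalComplex

variable {C₁ C₂ D : Type*} [Category* C₁] [Category* C₂] [Category* D]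
  [Preadditive C₁] [Preadditive C₂] [Preadditive D] (F : C₁ ⥤ C₂ ⥤ D) [F.Additive]
  [∀ X, (F.obj X).Additive]

instance CategoryTheory.Functor.flip_additive : F.flip.Additive where
  map_add {X Y f g} := by
    ext Z
    exact (F.obj Z).map_add

instance CategoryTheory.Functor.flip_obj_additive (X : C₂) : (F.flip.obj X).Additive where
  map_add {Y Z f g} := by
    change (F.map (f + g)).app X = (F.map f).app X + (F.map g).app X
    rw [F.map_add]
    rfl

theorem HomologicalComplex.mapBifunctorMap_add_right {K K' : CochainComplex C₁ ℤ}
    {L L' : CochainComplex C₂ ℤ} [HasMapBifunctor K L F (.up ℤ)] [HasMapBifunctor K' L' F (.up ℤ)]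
    (f : K ⟶ K') (g g' : L ⟶ L') :
    mapBifunctorMap f (g + g') F (.up ℤ) =
      mapBifunctorMap f g F (.up ℤ) + mapBifunctorMap f g' F (.up ℤ) := by
  ext n : 1
  apply mapBifunctor.hom_ext
  intro p q h
  rw [add_f_apply, Preadditive.comp_add]
  simp only [ι_mapBifunctorMap, add_f_apply, Functor.map_add, Preadditive.add_comp,
    Preadditive.comp_add]

theorem HomologicalComplex.mapBifunctorMap_add_left {K K' : CochainComplex C₁ ℤ}
    {L L' : CochainComplex C₂ ℤ} [HasMapBifunctor K L F (.up ℤ)] [HasMapBifunctor K' L' F (.up ℤ)]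
    (f f' : K ⟶ K') (g : L ⟶ L') :
    mapBifunctorMap (f + f') g F (.up ℤ) =
      mapBifunctorMap f g F (.up ℤ) + mapBifunctorMap f' g F (.up ℤ) := by
  ext n : 1
  apply mapBifunctor.hom_ext
  intro p q h
  rw [add_f_apply, Preadditive.comp_add]
  simp only [ι_mapBifunctorMap, add_f_apply, Functor.map_add, Preadditive.add_comp,
    NatTrans.app_add]

variable [∀ (K₁ : CochainComplex C₁ ℤ) (K₂ : CochainComplex C₂ ℤ), HasMapBifunctor K₁ K₂ F (.up ℤ)]

instance CategoryTheory.Functor.map₂CochainComplex_obj_additive (K : CochainComplex C₁ ℤ) :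
    (F.map₂CochainComplex.obj K).Additive where
  map_add := mapBifunctorMap_add_right F _ _ _

instance CategoryTheory.Functor.map₂CochainComplex_flip_obj_additive (K : CochainComplex C₂ ℤ) :
    (F.map₂CochainComplex.flip.obj K).Additive where
  map_add := mapBifunctorMap_add_left F _ _ _

theorem HomologicalComplex.mapBifunctor_splitting
    {S : ShortComplex (CochainComplex C₂ ℤ)}
    (σ : ∀ n, (S.map (HomologicalComplex.eval C₂ (.up ℤ) n)).Splitting)
    (K : CochainComplex C₁ ℤ) (n : ℤ) :
    Nonempty ((S.map (F.map₂CochainComplex.obj K)).map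
      (HomologicalComplex.eval D (.up ℤ) n)).Splitting := by
  obtain ⟨ρ, τ, hfr, hsg, hid⟩ : ∃ (ρ : ∀ q, S.X₂.X q ⟶ S.X₁.X q) (τ : ∀ q, S.X₃.X q ⟶ S.X₂.X q),
      (∀ q, S.f.f q ≫ ρ q = 𝟙 _) ∧ (∀ q, τ q ≫ S.g.f q = 𝟙 _) ∧
        ∀ q, ρ q ≫ S.f.f q + S.g.f q ≫ τ q = 𝟙 _ :=
    ⟨fun q ↦ (σ q).r, fun q ↦ (σ q).s, fun q ↦ (σ q).f_r, fun q ↦ (σ q).s_g, fun q ↦ (σ q).id⟩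
  let r : (mapBifunctor K S.X₂ F (.up ℤ)).X n ⟶ (mapBifunctor K S.X₁ F (.up ℤ)).X n :=
    mapBifunctorDesc fun p q h ↦ (F.obj (K.X p)).map (ρ q) ≫ ιMapBifunctor K S.X₁ F _ p q n h
  let s : (mapBifunctor K S.X₃ F (.up ℤ)).X n ⟶ (mapBifunctor K S.X₂ F (.up ℤ)).X n :=
    mapBifunctorDesc fun p q h ↦ (F.obj (K.X p)).map (τ q) ≫ ιMapBifunctor K S.X₂ F _ p q n h
  have h1 : (mapBifunctorMap (𝟙 K) S.f F (.up ℤ)).f n ≫ r = 𝟙 _ := by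
    apply mapBifunctor.hom_ext
    intro p q h
    rw [ι_mapBifunctorMap_assoc, ι_mapBifunctorDesc, ← Functor.map_comp_assoc, hfr]
    simp
  have h2 : s ≫ (mapBifunctorMap (𝟙 K) S.g F (.up ℤ)).f n = 𝟙 _ := by
    apply mapBifunctor.hom_ext
    intro p q h
    rw [ι_mapBifunctorDesc_assoc, Category.assoc, ι_mapBifunctorMap]
    simp only [id_f, CategoryTheory.Functor.map_id, NatTrans.id_app, Category.id_comp,
      Category.comp_id]
    rw [← Functor.map_comp_assoc]
    rw [hsg]
    simp
  have h3 : r ≫ (mapBifunctorMap (𝟙 K) S.f F (.up ℤ)).f n +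
      (mapBifunctorMap (𝟙 K) S.g F (.up ℤ)).f n ≫ s = 𝟙 _ := by
    apply mapBifunctor.hom_ext
    intro p q h
    rw [Preadditive.comp_add, ι_mapBifunctorDesc_assoc, Category.assoc, ι_mapBifunctorMap,
      ι_mapBifunctorMap_assoc, ι_mapBifunctorDesc]
    simp only [id_f, CategoryTheory.Functor.map_id, NatTrans.id_app, Category.id_comp,
      Category.comp_id]
    rw [← Functor.map_comp_assoc, ← Functor.map_comp_assoc, ← Preadditive.add_comp,
      ← Functor.map_add]
    rw [hid]
    simp
  exact ⟨{ r := r, s := s, f_r := h1, s_g := h2, id := h3 }⟩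

end Bifunctor

namespace HomologicalComplex.HomologySequence

variable {C : Type*} [Category* C] [Abelian C] {S₁ S₂ : ShortComplex (CochainComplex C ℤ)}

theorem quasiIso_τ₂ (φ : S₁ ⟶ S₂) (hS₁ : S₁.ShortExact) (hS₂ : S₂.ShortExact)
    (h₁ : QuasiIso φ.τ₁) (h₃ : QuasiIso φ.τ₃) : QuasiIso φ.τ₂ := by
  rw [quasiIso_iff]
  intro i
  rw [quasiIsoAt_iff_isIso_homologyMap]
  have h : (ComplexShape.up ℤ).Rel (i - 1) i := by simp
  have h' : (ComplexShape.up ℤ).Rel i (i + 1) := by simp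
  have w₁ : homologyMap S₁.f i ≫ homologyMap φ.τ₂ i = homologyMap φ.τ₁ i ≫ homologyMap S₂.f i := by
    rw [← homologyMap_comp, ← homologyMap_comp, φ.comm₁₂]
  have w₂ : homologyMap S₁.g i ≫ homologyMap φ.τ₃ i = homologyMap φ.τ₂ i ≫ homologyMap S₂.g i := by
    rw [← homologyMap_comp, ← homologyMap_comp, φ.comm₂₃]
  let ψ : ComposableArrows.mk₄ (hS₁.δ _ _ h) (homologyMap S₁.f i) (homologyMap S₁.g i)
        (hS₁.δ _ _ h') ⟶
      ComposableArrows.mk₄ (hS₂.δ _ _ h) (homologyMap S₂.f i) (homologyMap S₂.g i)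
        (hS₂.δ _ _ h') :=
    ComposableArrows.homMk₄ (homologyMap φ.τ₃ (i - 1)) (homologyMap φ.τ₁ i) (homologyMap φ.τ₂ i)
      (homologyMap φ.τ₃ i) (homologyMap φ.τ₁ (i + 1)) (δ_naturality φ hS₁ hS₂ _ _ h) w₁ w₂
      (δ_naturality φ hS₁ hS₂ _ _ h')
  have hex {S : ShortComplex (CochainComplex C ℤ)} (hS : S.ShortExact) :
      (ComposableArrows.mk₄ (hS.δ _ _ h) (homologyMap S.f i) (homologyMap S.g i)
        (hS.δ _ _ h')).Exact :=
    ComposableArrows.exact_of_δ₀ (hS.homology_exact₁ _ _ h).exact_toComposableArrows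
      (ComposableArrows.exact_of_δ₀ (hS.homology_exact₂ _).exact_toComposableArrows
        (hS.homology_exact₃ _ _ h').exact_toComposableArrows)
  exact Abelian.isIso_of_epi_of_isIso_of_isIso_of_mono (hex hS₁) (hex hS₂) ψ
    (inferInstanceAs (Epi (homologyMap φ.τ₃ (i - 1))))
    (inferInstanceAs (IsIso (homologyMap φ.τ₁ i)))
    (inferInstanceAs (IsIso (homologyMap φ.τ₃ i)))
    (inferInstanceAs (Mono (homologyMap φ.τ₁ (i + 1))))

end HomologicalComplex.HomologySequence

section MapBifunctorSingle

open HomologicalComplex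

variable {C₁ C₂ D : Type*} [Category* C₁] [Category* C₂] [Category* D]
  [Preadditive C₁] [Preadditive C₂] [Preadditive D] [HasZeroObject C₂] (F : C₁ ⥤ C₂ ⥤ D)
  [F.Additive] [∀ X, (F.obj X).Additive]

namespace HomologicalComplex

section

variable (K : CochainComplex C₁ ℤ) (q : ℤ) (M : C₂)
  [HasMapBifunctor K ((single C₂ (.up ℤ) q).obj M) F (.up ℤ)]

/-- The terms of `mapBifunctor K ((single _ _ q).obj M) F` are obtained by applying `F.flip.obj M`
to those of `K`. -/
noncomputable def mapBifunctorSingleXIso (p n : ℤ) (h : p + q = n) :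
    (F.obj (K.X p)).obj M ≅ (mapBifunctor K ((single C₂ (.up ℤ) q).obj M) F (.up ℤ)).X n where
  hom := (F.obj (K.X p)).map (singleObjXSelf (.up ℤ) q M).inv ≫ ιMapBifunctor K _ F _ p q n h
  inv := mapBifunctorDesc fun p' q' h' ↦
    if hq : q' = q then
      (F.map (K.XIsoOfEq (show p' = p by
        have : p' + q' = n := h'
        lia)).hom).app _ ≫ (F.obj (K.X p)).map (singleObjXIsoOfEq (.up ℤ) q M q' hq).hom
    else 0
  hom_inv_id := by
    rw [Category.assoc, ι_mapBifunctorDesc, dif_pos rfl]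
    have : (singleObjXSelf (.up ℤ) q M).inv ≫ (singleObjXIsoOfEq (.up ℤ) q M q rfl).hom = 𝟙 _ :=
      (singleObjXSelf (.up ℤ) q M).inv_hom_id
    simp [← Functor.map_comp, XIsoOfEq, this]
  inv_hom_id := by
    apply mapBifunctor.hom_ext
    intro p' q' h'
    rw [ι_mapBifunctorDesc_assoc, Category.comp_id]
    by_cases hq : q' = q
    · subst hq
      obtain rfl : p' = p := by
        have : p' + q' = n := h'
        lia
      rw [dif_pos rfl]
      have : (singleObjXIsoOfEq (.up ℤ) q' M q' rfl).hom ≫ (singleObjXSelf (.up ℤ) q' M).inv = 𝟙 _ :=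
        (singleObjXSelf (.up ℤ) q' M).hom_inv_id
      rw [Category.assoc, ← Functor.map_comp_assoc, this]
      simp [XIsoOfEq]
    · exact (((F.obj (K.X p')).map_isZero (isZero_single_obj_X _ _ _ _ hq))).eq_of_src _ _

theorem mapBifunctorSingleXIso_hom_d (p p' n n' : ℤ) (h : p + q = n) (h' : p' + q = n')
    (hp : p + 1 = p') :
    (mapBifunctorSingleXIso F K q M p n h).hom ≫
      (mapBifunctor K ((single C₂ (.up ℤ) q).obj M) F (.up ℤ)).d n n' =
    (F.map (K.d p p')).app M ≫ (mapBifunctorSingleXIso F K q M p' n' h').hom := by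
  have h₂ : mapBifunctor.d₂ K ((single C₂ (.up ℤ) q).obj M) F (.up ℤ) p q n' = 0 := by
    rw [mapBifunctor.d₂_eq' _ _ _ _ _ (show (ComplexShape.up ℤ).Rel q (q + 1) by simp)]
    simp
  have hε : ComplexShape.ε₁ (.up ℤ) (.up ℤ) (.up ℤ) (p, q) = 1 := rfl
  dsimp only [mapBifunctorSingleXIso]
  rw [mapBifunctor.d_eq, Category.assoc, Preadditive.comp_add, mapBifunctor.ι_D₁,
    mapBifunctor.ι_D₂, h₂, add_zero, mapBifunctor.d₁_eq _ _ _ _ hp _ _ h', hε,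
    one_smul, NatTrans.naturality_assoc]

variable {K} in
theorem mapBifunctorSingleXIso_hom_naturality {K' : CochainComplex C₁ ℤ} (f : K ⟶ K')
    [HasMapBifunctor K' ((single C₂ (.up ℤ) q).obj M) F (.up ℤ)] (p n : ℤ) (h : p + q = n) :
    (mapBifunctorSingleXIso F K q M p n h).hom ≫
      (mapBifunctorMap f (𝟙 _) F (.up ℤ)).f n =
    (F.map (f.f p)).app M ≫ (mapBifunctorSingleXIso F K' q M p n h).hom := by
  dsimp only [mapBifunctorSingleXIso]
  rw [Category.assoc, ι_mapBifunctorMap]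
  simp

/-- The short complexes that are involved in the computation of the homology of
`mapBifunctor K ((single _ _ q).obj M) F` are obtained by applying `F.flip.obj M`. -/
noncomputable def mapBifunctorSingleScIso (p p' p'' n n' n'' : ℤ) (h : p + q = n) (h' : p' + q = n')
    (h'' : p'' + q = n'') (hp : p + 1 = p') (hp' : p' + 1 = p'') :
    (K.sc' p p' p'').map (F.flip.obj M) ≅
      (mapBifunctor K ((single C₂ (.up ℤ) q).obj M) F (.up ℤ)).sc' n n' n'' :=
  ShortComplex.isoMk (mapBifunctorSingleXIso F K q M p n h)
    (mapBifunctorSingleXIso F K q M p' n' h') (mapBifunctorSingleXIso F K q M p'' n'' h'')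
    (mapBifunctorSingleXIso_hom_d F K q M p p' n n' h h' hp)
    (mapBifunctorSingleXIso_hom_d F K q M p' p'' n' n'' h' h'' hp')

end

variable [CategoryWithHomology C₁] [CategoryWithHomology D]

/-- The homology of `mapBifunctor K ((single _ _ q).obj M) F`. -/
noncomputable def mapBifunctorSingleHomologyIso (K : CochainComplex C₁ ℤ) (q : ℤ) (M : C₂)
    [HasMapBifunctor K ((single C₂ (.up ℤ) q).obj M) F (.up ℤ)] (p n : ℤ) (h : p + q = n) :
    (((F.flip.obj M).mapHomologicalComplex (.up ℤ)).obj K).homology p ≅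
      (mapBifunctor K ((single C₂ (.up ℤ) q).obj M) F (.up ℤ)).homology n :=
  homologyIsoSc' _ (p - 1) p (p + 1) (by simp) (by simp) ≪≫
    ShortComplex.homologyMapIso (mapBifunctorSingleScIso F K q M (p - 1) p (p + 1) (n - 1) n (n + 1)
      (by lia) h (by lia) (by lia) rfl) ≪≫
    (homologyIsoSc' _ (n - 1) n (n + 1) (by simp) (by simp)).symm

theorem quasiIso_mapBifunctorMap_single {K K' : CochainComplex C₁ ℤ} (f : K ⟶ K') [QuasiIso f]
    (q : ℤ) (M : C₂) [HasMapBifunctor K ((single C₂ (.up ℤ) q).obj M) F (.up ℤ)]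
    [HasMapBifunctor K' ((single C₂ (.up ℤ) q).obj M) F (.up ℤ)]
    [(F.flip.obj M).PreservesHomology] :
    QuasiIso (mapBifunctorMap f (𝟙 ((single C₂ (.up ℤ) q).obj M)) F (.up ℤ)) := by
  refine ⟨fun n ↦ ?_⟩
  rw [quasiIsoAt_iff' _ (n - 1) n (n + 1) (by simp) (by simp)]
  have hf := (quasiIsoAt_iff' f (n - q - 1) (n - q) (n - q + 1) (by simp) (by simp)).1 inferInstance
  have hf' := ShortComplex.quasiIso_map_of_preservesLeftHomology (F.flip.obj M)
    ((shortComplexFunctor' C₁ (.up ℤ) (n - q - 1) (n - q) (n - q + 1)).map f)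
  refine (ShortComplex.quasiIso_iff_of_arrow_mk_iso _ _ (Arrow.isoMk
    (mapBifunctorSingleScIso F K q M (n - q - 1) (n - q) (n - q + 1) (n - 1) n (n + 1)
      (by lia) (by lia) (by lia) (by lia) rfl)
    (mapBifunctorSingleScIso F K' q M (n - q - 1) (n - q) (n - q + 1) (n - 1) n (n + 1)
      (by lia) (by lia) (by lia) (by lia) rfl) ?_)).1 hf'
  apply ShortComplex.hom_ext
  · exact mapBifunctorSingleXIso_hom_naturality F q M f _ _ _
  · exact mapBifunctorSingleXIso_hom_naturality F q M f _ _ _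
  · exact mapBifunctorSingleXIso_hom_naturality F q M f _ _ _

end HomologicalComplex

end MapBifunctorSingle

section MapBifunctorQuasiIso

open HomologicalComplex

namespace CochainComplex

/-- A cochain complex that vanishes in degrees `< m` sits in a degreewise split short exact sequence
whose cokernel is concentrated in degree `m`. -/
theorem exists_splitting_single {C : Type*} [Category* C] [Abelian C] (B : CochainComplex C ℤ)
    (m : ℤ) (hB : ∀ n < m, IsZero (B.X n)) :
    ∃ (K : CochainComplex C ℤ) (f : K ⟶ B) (g : B ⟶ (single C (.up ℤ) m).obj (B.X m))
      (w : f ≫ g = 0),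
      (∀ n, Nonempty ((ShortComplex.mk f g w).map (eval C (.up ℤ) n)).Splitting) ∧
        (∀ n, n ≤ m → IsZero (K.X n)) ∧ ∀ n, n ≠ m → IsIso (f.f n) := by
  let g : B ⟶ (single C (.up ℤ) m).obj (B.X m) :=
    mkHomToSingle (𝟙 _) fun i hi ↦ (hB i (by simp at hi; lia)).eq_of_src _ _
  have hS : (ShortComplex.mk (kernel.ι g) g (kernel.condition g)).Exact :=
    ShortComplex.exact_kernel g
  have hS' (n) : ((ShortComplex.mk (kernel.ι g) g (kernel.condition g)).map
      (eval C (.up ℤ) n)).Exact := hS.map _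
  have hm : IsIso (g.f m) := by
    dsimp only [g]
    rw [mkHomToSingle_f]
    infer_instance
  have hmono (n) : Mono ((kernel.ι g).f n) := inferInstance
  have h0 : IsZero ((kernel g).X m) := by
    refine (IsZero.iff_id_eq_zero _).2 ?_
    rw [← cancel_mono ((kernel.ι g).f m), ← cancel_mono (g.f m), Category.assoc, ← comp_f,
      kernel.condition]
    simp
  have hiso (n) (hn : n ≠ m) : IsIso ((kernel.ι g).f n) := by
    have : Epi ((kernel.ι g).f n) := (hS' n).epi_f
      ((isZero_single_obj_X (.up ℤ) m (B.X m) n hn).eq_of_tgt _ _)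
    exact isIso_of_mono_of_epi _
  refine ⟨kernel g, kernel.ι g, g, kernel.condition g, fun n ↦ ?_, fun n hn ↦ ?_, hiso⟩
  · by_cases hn : n = m
    · subst hn
      have : IsIso (((ShortComplex.mk (kernel.ι g) g (kernel.condition g)).map
        (eval C (.up ℤ) n)).g) := hm
      exact ⟨ShortComplex.Splitting.ofIsZeroOfIsIso _ h0 this⟩
    · have : IsIso (((ShortComplex.mk (kernel.ι g) g (kernel.condition g)).map
        (eval C (.up ℤ) n)).f) := hiso n hn
      exact ⟨ShortComplex.Splitting.ofIsIsoOfIsZero _ this (isZero_single_obj_X (.up ℤ) m (B.X m) n hn)⟩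
  · obtain rfl | hn' := eq_or_ne n m
    · exact h0
    · have := hiso n hn'
      exact (hB n (by lia)).of_iso (asIso ((kernel.ι g).f n))

end CochainComplex

namespace HomologicalComplex

variable {C₁ C₂ D : Type*} [Category* C₁] [Category* C₂] [Category* D]
  [Abelian C₁] [Abelian C₂] [Abelian D] (F : C₁ ⥤ C₂ ⥤ D)
  [F.Additive] [∀ X, (F.obj X).Additive]
  [∀ (K₁ : CochainComplex C₁ ℤ) (K₂ : CochainComplex C₂ ℤ), HasMapBifunctor K₁ K₂ F (.up ℤ)]

theorem quasiIso_mapBifunctorMap_left {A A' : CochainComplex C₁ ℤ} (f : A ⟶ A') [QuasiIso f]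
    (B : CochainComplex C₂ ℤ) (a b : ℤ) (hB : ∀ n, n < a ∨ b < n → IsZero (B.X n))
    (hF : ∀ n, PreservesFiniteLimits (F.flip.obj (B.X n)))
    (hF' : ∀ n, PreservesFiniteColimits (F.flip.obj (B.X n))) :
    QuasiIso (mapBifunctorMap f (𝟙 B) F (.up ℤ)) := by
  obtain ⟨k, hk⟩ : ∃ k : ℕ, b < a + k := ⟨(b - a + 1).toNat, by lia⟩
  replace hB (n) (hn : n < a ∨ a + k ≤ n) : IsZero (B.X n) := hB n (by lia)
  replace hF (n) (hn : a ≤ n) := hF n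
  replace hF' (n) (hn : a ≤ n) := hF' n
  clear hk
  induction k generalizing a B with
  | zero =>
    have h {K : CochainComplex C₁ ℤ} : IsZero (mapBifunctor K B F (.up ℤ)) := by
      have hB' : IsZero B := (IsZero.iff_id_eq_zero _).2 (by
        ext n
        exact (hB n (by lia)).eq_of_src _ _)
      exact (F.map₂CochainComplex.obj K).map_isZero hB'
    have : IsIso (mapBifunctorMap f (𝟙 B) F (.up ℤ)) :=
      ⟨0, h.eq_of_src _ _, h.eq_of_src _ _⟩
    infer_instance
  | succ k ih =>
    obtain ⟨K, i, g, w, hs, hK, hi⟩ := CochainComplex.exists_splitting_single B a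
      fun n hn ↦ hB n (by lia)
    let S := ShortComplex.mk i g w
    have hS (L : CochainComplex C₁ ℤ) : (S.map (F.map₂CochainComplex.obj L)).ShortExact := by
      refine shortExact_of_degreewise_shortExact _ fun n ↦ ?_
      obtain ⟨σ⟩ := mapBifunctor_splitting F (fun n ↦ (hs n).some) L n
      exact σ.shortExact
    let φ : S.map (F.map₂CochainComplex.obj A) ⟶ S.map (F.map₂CochainComplex.obj A') :=
      S.mapNatTrans (F.map₂CochainComplex.map f)
    have e (n) (hn : n ≠ a) : K.X n ≅ B.X n :=
      have := hi n hn
      asIso (i.f n)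
    have := hF a le_rfl
    have := hF' a le_rfl
    refine HomologySequence.quasiIso_τ₂ φ (hS A) (hS A') (ih K (a + 1) (fun n hn ↦ ?_)
      (fun n hn ↦ ?_) fun n hn ↦ ?_) (quasiIso_mapBifunctorMap_single F f a (B.X a))
    · by_cases hn' : n ≤ a
      · exact hK n hn'
      · exact (hB n (by lia)).of_iso (e n (by lia))
    · have := hF n (by lia)
      exact preservesFiniteLimits_of_natIso (F.flip.mapIso (e n (by lia)).symm)
    · have := hF' n (by lia)
      exact preservesFiniteColimits_of_natIso (F.flip.mapIso (e n (by lia)).symm)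

theorem quasiIso_mapBifunctorMap_right (A : CochainComplex C₁ ℤ) {B B' : CochainComplex C₂ ℤ}
    (g : B ⟶ B') [QuasiIso g] (a b : ℤ) (hA : ∀ n, n < a ∨ b < n → IsZero (A.X n))
    (hF : ∀ n, PreservesFiniteLimits (F.obj (A.X n)))
    (hF' : ∀ n, PreservesFiniteColimits (F.obj (A.X n))) :
    QuasiIso (mapBifunctorMap (𝟙 A) g F (.up ℤ)) := by
  have h1 : QuasiIso (mapBifunctorMap g (𝟙 A) F.flip (.up ℤ)) :=
    quasiIso_mapBifunctorMap_left F.flip g A a b hA hF hF'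
  have h2 : mapBifunctorMap (𝟙 A) g F (.up ℤ) = (mapBifunctorFlipIso A B F (.up ℤ)).inv ≫
      mapBifunctorMap g (𝟙 A) F.flip (.up ℤ) ≫ (mapBifunctorFlipIso A B' F (.up ℤ)).hom := by
    rw [mapBifunctorFlipIso_hom_naturality, Iso.inv_hom_id_assoc]
  rw [h2]
  infer_instance

end HomologicalComplex

end MapBifunctorQuasiIso

namespace HomologicalComplex

section MapDouble

variable {C D : Type*} [Category* C] [Category* D] [Abelian C] [Abelian D]
  {ι : Type*} {c : ComplexShape ι} {i₀ i₁ : ι} (hi : c.Rel i₀ i₁) (G : C ⥤ D) [G.Additive]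
  {X₀ X₁ : C} (f : X₀ ⟶ X₁)

theorem isZero_homology_map_double (n : ι) (h₀ : n ≠ i₀) (h₁ : n ≠ i₁) :
    IsZero (((G.mapHomologicalComplex c).obj (double f hi)).homology n) :=
  (exactAt_iff_isZero_homology _ _).1 <| ShortComplex.exact_of_isZero_X₂ _ <|
    G.map_isZero (isZero_double_X f hi n h₀ h₁)

/-- The homology in the first degree of the image of a two-term complex by an additive functor. -/
noncomputable def homologyMapDoubleIso₀ (h : i₀ ≠ i₁) :
    ((G.mapHomologicalComplex c).obj (double f hi)).homology i₀ ≅ kernel (G.map f) :=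
  let L := (G.mapHomologicalComplex c).obj (double f hi)
  (L.isoHomologyπ (c.prev i₀) i₀ rfl (by
    change G.map ((double f hi).d _ _) = 0
    rw [double_d_eq_zero₁ f hi _ _ h, G.map_zero])).symm ≪≫
  (L.cyclesIsKernel i₀ i₁ (c.next_eq' hi)).conePointUniqueUpToIso (kernelIsKernel (L.d i₀ i₁)) ≪≫
  kernel.mapIso _ _ (G.mapIso (doubleXIso₀ f hi)) (G.mapIso (doubleXIso₁ f hi h)) (by
    change G.map ((double f hi).d _ _) ≫ G.map _ = G.map _ ≫ G.map f
    rw [double_d _ _ h, ← G.map_comp, ← G.map_comp]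
    simp)

/-- The homology in the last degree of the image of a two-term complex by an additive functor. -/
noncomputable def homologyMapDoubleIso₁ (h : i₀ ≠ i₁) :
    ((G.mapHomologicalComplex c).obj (double f hi)).homology i₁ ≅ cokernel (G.map f) :=
  let L := (G.mapHomologicalComplex c).obj (double f hi)
  L.isoHomologyι i₁ (c.next i₁) rfl (by
    change G.map ((double f hi).d _ _) = 0
    rw [double_d_eq_zero₀ f hi _ _ h.symm, G.map_zero]) ≪≫
  (L.opcyclesIsCokernel i₀ i₁ (c.prev_eq' hi)).coconePointUniqueUpToIso
    (cokernelIsCokernel (L.d i₀ i₁)) ≪≫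
  cokernel.mapIso _ _ (G.mapIso (doubleXIso₀ f hi)) (G.mapIso (doubleXIso₁ f hi h)) (by
    change G.map ((double f hi).d _ _) ≫ G.map _ = G.map _ ≫ G.map f
    rw [double_d _ _ h, ← G.map_comp, ← G.map_comp]
    simp)

end MapDouble

end HomologicalComplex

namespace CategoryTheory

open HomologicalComplex

variable {C D : Type*} [Category* C] [Category* D] [Abelian C] [Abelian D]

theorem ShortComplex.ShortExact.nonempty_cokernel_map_iso {S : ShortComplex C} (hS : S.ShortExact)
    (G : C ⥤ D) [G.Additive] [PreservesFiniteColimits G] :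
    Nonempty (cokernel (G.map S.f) ≅ G.obj S.X₃) := by
  have := hS.epi_g
  exact ⟨(cokernelIsCokernel _).coconePointUniqueUpToIso
    (CokernelCofork.mapIsColimit _ hS.exact.gIsCokernel G)⟩

/-- The projective resolution of length one given by a short exact sequence whose first two
terms are projective. -/
noncomputable def ShortComplex.ShortExact.projectiveResolution {S : ShortComplex C}
    (hS : S.ShortExact) [Projective S.X₁] [Projective S.X₂] : ProjectiveResolution S.X₃ where
  complex := double (c := ComplexShape.down ℕ) (i₀ := 1) (i₁ := 0) S.f rfl
  projective n := projective_double_X _ _ n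
  π := doubleToSingle (c := ComplexShape.down ℕ) rfl one_ne_zero S.f S.g S.zero
  quasiIso := quasiIso_doubleToSingle _ _ hS

/-- The first left derived functor computed with a projective resolution of length one. -/
noncomputable def ShortComplex.ShortExact.leftDerivedOneIso {S : ShortComplex C}
    (hS : S.ShortExact) [Projective S.X₁] [Projective S.X₂] [HasProjectiveResolutions C]
    (G : C ⥤ D) [G.Additive] :
    (G.leftDerived 1).obj S.X₃ ≅ kernel (G.map S.f) :=
  hS.projectiveResolution.isoLeftDerivedObj G 1 ≪≫ homologyMapDoubleIso₀ (by simp) G S.f one_ne_zero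

end CategoryTheory

section FiniteBiproducts

attribute [local instance] Abelian.hasFiniteBiproducts

theorem CategoryTheory.Limits.biproduct.isIso_desc_of_isZero {C J : Type*} [Category* C]
    [Preadditive C] [Fintype J] {X : J → C} [HasBiproduct X] {Y : C} (f : ∀ j, X j ⟶ Y) (j₀ : J)
    (hX : ∀ j, j ≠ j₀ → IsZero (X j)) [IsIso (f j₀)] : IsIso (biproduct.desc f) := by
  refine ⟨inv (f j₀) ≫ biproduct.ι X j₀, ?_, by simp⟩
  apply biproduct.hom_ext'
  intro j
  obtain rfl | h := eq_or_ne j j₀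
  · simp
  · exact (hX j h).eq_of_src _ _

theorem CategoryTheory.Limits.isZero_biproduct {C J : Type*} [Category* C]
    [Preadditive C] {X : J → C} [HasBiproduct X] (hX : ∀ j, IsZero (X j)) : IsZero (⨁ X) := by
  rw [IsZero.iff_id_eq_zero]
  apply biproduct.hom_ext'
  intro j
  exact (hX j).eq_of_src _ _

namespace CochainComplex

open HomologicalComplex

variable {C : Type*} [Category* C] [Abelian C]

theorem quasiIso_biproduct_desc {J : Type} [Fintype J] (deg : J → ℤ)
    (hdeg : Function.Injective deg) {K : CochainComplex C ℤ}
    (hK : ∀ n, n ∉ Set.range deg → IsZero (K.X n))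
    {L : J → CochainComplex C ℤ} (φ : ∀ j, L j ⟶ K)
    (hL : ∀ j n, n ≠ deg j → (L j).ExactAt n) [∀ j, IsIso (homologyMap (φ j) (deg j))] :
    QuasiIso (biproduct.desc φ) := by
  refine ⟨fun n ↦ ?_⟩
  rw [quasiIsoAt_iff_isIso_homologyMap]
  let H := homologyFunctor C (.up ℤ) n
  change IsIso (H.map (biproduct.desc φ))
  rw [← isIso_comp_left_iff (H.mapBiproduct L).inv, biproduct.mapBiproduct_inv_map_desc]
  have hz (j) (hj : n ≠ deg j) : IsZero (H.obj (L j)) :=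
    (exactAt_iff_isZero_homology _ _).1 (hL j n hj)
  by_cases hn : n ∈ Set.range deg
  · obtain ⟨j, rfl⟩ := hn
    have : IsIso (H.map (φ j)) := ‹∀ j, IsIso (homologyMap (φ j) (deg j))› j
    exact biproduct.isIso_desc_of_isZero _ j fun j' hj' ↦ hz j' (hdeg.ne hj').symm
  · refine ⟨0, (isZero_biproduct fun j ↦ hz j fun h ↦ hn ⟨j, h.symm⟩).eq_of_src _ _,
      IsZero.eq_of_src ?_ _ _⟩
    exact (exactAt_iff_isZero_homology _ _).1 (ShortComplex.exact_of_isZero_X₂ _ (hK n hn))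

end CochainComplex

namespace HomologicalComplex

instance quasiIso_biproduct_map {C ι : Type*} [Category* C] [Abelian C] {J : Type} [Fintype J]
    {c : ComplexShape ι} {K L : J → HomologicalComplex C c} (φ : ∀ j, K j ⟶ L j)
    [∀ j, QuasiIso (φ j)] : QuasiIso (biproduct.map φ) := by
  refine ⟨fun n ↦ ?_⟩
  rw [quasiIsoAt_iff_isIso_homologyMap]
  let H := homologyFunctor C c n
  change IsIso (H.map (biproduct.map φ))
  have hφ (j) : IsIso (H.map (φ j)) := inferInstanceAs (IsIso (homologyMap (φ j) n))
  have : H.map (biproduct.map φ) = (H.mapBiproduct K).hom ≫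
      (biproduct.mapIso fun j ↦ asIso (H.map (φ j))).hom ≫ (H.mapBiproduct L).inv := by
    rw [← Category.assoc, Iso.eq_comp_inv]
    apply biproduct.hom_ext
    intro j
    simp only [Functor.mapBiproduct_hom, Category.assoc, biproduct.lift_π,
      biproduct.mapIso_hom, biproduct.map_π, biproduct.lift_π_assoc]
    simp [← Functor.map_comp]
  rw [this]
  infer_instance

end HomologicalComplex

namespace HomologicalComplex

variable {C₁ C₂ D : Type*} [Category* C₁] [Category* C₂] [Category* D]
  [Abelian C₁] [Abelian C₂] [Abelian D] (F : C₁ ⥤ C₂ ⥤ D)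
  [F.Additive] [∀ X, (F.obj X).Additive]

/-- The homology of `mapBifunctor ((single _ _ p).obj M) L F` is that of the image of `L` under
`F.obj M`, up to a shift. -/
noncomputable def singleMapBifunctorHomologyIso (p : ℤ) (M : C₁) (L : CochainComplex C₂ ℤ)
    [HasMapBifunctor ((single C₁ (.up ℤ) p).obj M) L F (.up ℤ)] (q n : ℤ) (h : q + p = n) :
    (mapBifunctor ((single C₁ (.up ℤ) p).obj M) L F (.up ℤ)).homology n ≅
      (((F.obj M).mapHomologicalComplex (.up ℤ)).obj L).homology q :=
  (homologyFunctor D (.up ℤ) n).mapIso (mapBifunctorFlipIso _ L F (.up ℤ)).symm ≪≫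
    (mapBifunctorSingleHomologyIso F.flip L p M q n h).symm

variable [∀ (K₁ : CochainComplex C₁ ℤ) (K₂ : CochainComplex C₂ ℤ), HasMapBifunctor K₁ K₂ F (.up ℤ)]

/-- The homology of a bifunctor evaluated on finite biproducts of complexes. -/
noncomputable def mapBifunctorBiproductHomologyIso {J J' : Type} [Fintype J] [Fintype J']
    (K : J → CochainComplex C₁ ℤ) (L : J' → CochainComplex C₂ ℤ) (n : ℤ) :
    (mapBifunctor (⨁ K) (⨁ L) F (.up ℤ)).homology n ≅
      ⨁ fun j ↦ ⨁ fun j' ↦ (mapBifunctor (K j) (L j') F (.up ℤ)).homology n :=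
  let H := homologyFunctor D (.up ℤ) n
  H.mapIso ((F.map₂CochainComplex.flip.obj (⨁ L)).mapBiproduct K) ≪≫
    H.mapBiproduct _ ≪≫ biproduct.mapIso fun j ↦
      H.mapIso ((F.map₂CochainComplex.obj (K j)).mapBiproduct L) ≪≫ H.mapBiproduct _

end HomologicalComplex

namespace DirectSum

variable {R ι : Type*} [Semiring R] [DecidableEq ι] (U V : ι → Type*)
  [∀ i, AddCommMonoid (U i)] [∀ i, Module R (U i)] [∀ i, AddCommMonoid (V i)] [∀ i, Module R (V i)]

/-- A direct sum of modules that vanish outside of a finite set `s` is the product over `s`. -/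
noncomputable def linearEquivPiOfSubsingleton (s : Finset ι) (hU : ∀ i ∉ s, Subsingleton (U i)) :
    (DirectSum ι U) ≃ₗ[R] (∀ i : s, U i) :=
  LinearEquiv.ofBijective
    (LinearMap.pi fun i : s ↦ DirectSum.component R ι U i) (by
      refine ⟨fun x y h ↦ DFinsupp.ext fun i ↦ ?_, fun y ↦ ⟨DFinsupp.mk s y, ?_⟩⟩
      · by_cases hi : i ∈ s
        · exact congr_fun h ⟨i, hi⟩
        · have := hU i hi
          exact Subsingleton.elim _ _
      · ext i
        change DFinsupp.mk s y i = _
        simp [DFinsupp.mk_apply])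

/-- A finite product of binary products of modules is a binary product of direct sums. -/
noncomputable def piProdLinearEquiv (s : Finset ι) (hU : ∀ i ∉ s, Subsingleton (U i))
    (hV : ∀ i ∉ s, Subsingleton (V i)) :
    (∀ i : s, U i × V i) ≃ₗ[R] (DirectSum ι U) × (DirectSum ι V) :=
  { (Equiv.arrowProdEquivProdArrow s (fun i ↦ U i) (fun i ↦ V i)) with
    map_add' _ _ := rfl
    map_smul' _ _ := rfl : (∀ i : s, U i × V i) ≃ₗ[R] (∀ i : s, U i) × (∀ i : s, V i) } ≪≫ₗ
  (linearEquivPiOfSubsingleton U s hU).symm.prodCongr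
    (linearEquivPiOfSubsingleton V s hV).symm

end DirectSum

namespace CategoryTheory.Limits

variable {C J : Type*} [Category* C] [Preadditive C]

theorem biproduct.projective {X : J → C} [HasBiproduct X] [∀ j, Projective (X j)] :
    Projective (⨁ X) where
  factors f e _ := ⟨biproduct.desc fun j ↦ Projective.factorThru (biproduct.ι X j ≫ f) e, by
    apply biproduct.hom_ext'
    simp⟩

/-- A biproduct of objects all of which but two vanish is a binary biproduct. -/
noncomputable def biproduct.isoBiprod [HasBinaryBiproducts C] {X : J → C} [HasBiproduct X]
    (j₀ j₁ : J) (h : j₀ ≠ j₁) (hX : ∀ j, j ≠ j₀ → j ≠ j₁ → IsZero (X j)) :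
    ⨁ X ≅ X j₀ ⊞ X j₁ where
  hom := biprod.lift (biproduct.π X j₀) (biproduct.π X j₁)
  inv := biprod.desc (biproduct.ι X j₀) (biproduct.ι X j₁)
  hom_inv_id := by
    apply biproduct.hom_ext'
    intro j
    rw [biprod.lift_desc, Preadditive.comp_add]
    by_cases h₀ : j = j₀
    · subst h₀
      simp [biproduct.ι_π_ne_assoc X h]
    · by_cases h₁ : j = j₁
      · subst h₁
        simp [biproduct.ι_π_ne_assoc X h.symm]
      · exact (hX j h₀ h₁).eq_of_src _ _
  inv_hom_id := by
    ext
    · simp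
    · simp [biproduct.ι_π_ne X h]
    · simp [biproduct.ι_π_ne X h.symm]
    · simp

end CategoryTheory.Limits

namespace CochainComplex

open HomologicalComplex

variable {C : Type*} [Category* C] [Abelian C]

theorem exists_quasiIso_biproduct_double [EnoughProjectives C]
    (hproj : ∀ {X P : C} (i : X ⟶ P) [Mono i] [Projective P], Projective X)
    (K : CochainComplex C ℤ) (s : Finset ℤ) (hK : ∀ n ∉ s, IsZero (K.X n))
    (hr : ∀ p : ℤ, (ComplexShape.up ℤ).Rel (p - 1) p) :
    ∃ S : ℤ → ShortComplex C,
      (∀ p, (S p).ShortExact) ∧ (∀ p, Projective (S p).X₁) ∧ (∀ p, Projective (S p).X₂) ∧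
      (∀ p, Nonempty ((S p).X₃ ≅ K.homology p)) ∧
        ∃ φ : (⨁ fun p : s ↦ double (S p).f (hr p)) ⟶ K, QuasiIso φ := by
  choose X₀ X₁ f g w hS h₀ h₁ φ hφ using
    fun p : ℤ ↦ exists_double_hom (hr p) hproj (by lia) K
  refine ⟨fun p ↦ .mk (f p) (g p) (w p), hS, h₀, h₁, fun _ ↦ ⟨Iso.refl _⟩, biproduct.desc fun p ↦ φ p,
    quasiIso_biproduct_desc (fun p : s ↦ p) Subtype.val_injective
      (fun n hn ↦ hK n (by simpa using hn)) _
    fun p n hn ↦ ?_⟩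
  have : Mono (f p) := (hS p).mono_f
  exact double_exactAt _ (by lia) _ n hn

variable {J : Type} [Fintype J]

/-- The terms of a finite biproduct of complexes. -/
noncomputable def biproductXIso (L : J → CochainComplex C ℤ) (n : ℤ) :
    (⨁ L).X n ≅ ⨁ fun j ↦ (L j).X n :=
  (HomologicalComplex.eval C (.up ℤ) n).mapBiproduct L

end CochainComplex

namespace ModuleCat

open HomologicalComplex

variable {R : Type u} [CommRing R]

theorem flat_of_projective (M : ModuleCat.{u} R) [h : Projective M] : Module.Flat R M :=
  have : Module.Projective R M := (IsProjective.iff_projective M).2 h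
  inferInstance

theorem quasiIso_mapBifunctorMap_left_of_flat {A A' : CochainComplex (ModuleCat.{u} R) ℤ}
    (f : A ⟶ A') [QuasiIso f] (B : CochainComplex (ModuleCat.{u} R) ℤ) (a b : ℤ)
    (hB : ∀ n, n < a ∨ b < n → IsZero (B.X n)) (hflat : ∀ n, Module.Flat R (B.X n)) :
    QuasiIso (mapBifunctorMap f (𝟙 B) (curriedTensor (ModuleCat.{u} R)) (.up ℤ)) :=
  quasiIso_mapBifunctorMap_left _ f B a b hB
    (fun n ↦ have := hflat n; inferInstanceAs (PreservesFiniteLimits (tensorRight (B.X n))))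
    (fun n ↦ inferInstanceAs (PreservesFiniteColimits (tensorRight (B.X n))))

theorem quasiIso_mapBifunctorMap_right_of_flat (A : CochainComplex (ModuleCat.{u} R) ℤ)
    {B B' : CochainComplex (ModuleCat.{u} R) ℤ} (g : B ⟶ B') [QuasiIso g] (a b : ℤ)
    (hA : ∀ n, n < a ∨ b < n → IsZero (A.X n)) (hflat : ∀ n, Module.Flat R (A.X n)) :
    QuasiIso (mapBifunctorMap (𝟙 A) g (curriedTensor (ModuleCat.{u} R)) (.up ℤ)) :=
  quasiIso_mapBifunctorMap_right _ A g a b hA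
    (fun n ↦ have := hflat n; inferInstanceAs (PreservesFiniteLimits (tensorLeft (A.X n))))
    (fun n ↦ inferInstanceAs (PreservesFiniteColimits (tensorLeft (A.X n))))

section

variable {S : ℤ → ShortComplex (ModuleCat.{u} R)} (s : Finset ℤ)
  (hr : ∀ p : ℤ, (ComplexShape.up ℤ).Rel (p - 1) p)

theorem isZero_biproduct_double_X (a b : ℤ) (hs : ∀ p ∈ s, a ≤ p ∧ p ≤ b) (n : ℤ)
    (hn : n < a - 1 ∨ b < n) : IsZero ((⨁ fun p : s ↦ double (S p).f (hr p)).X n) :=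
  (isZero_biproduct fun p : s ↦ isZero_double_X (S p).f (hr p) n
    (by have := hs p p.2; lia) (by have := hs p p.2; lia)).of_iso (CochainComplex.biproductXIso _ n)

theorem flat_biproduct_double_X (h₁ : ∀ p, Projective (S p).X₁) (h₂ : ∀ p, Projective (S p).X₂)
    (n : ℤ) : Module.Flat R ((⨁ fun p : s ↦ double (S p).f (hr p)).X n) :=
  have (p : s) : Projective ((double (S p).f (hr p)).X n) :=
    have := h₁ p
    have := h₂ p
    projective_double_X _ _ n
  have : Projective ((⨁ fun p : s ↦ double (S p).f (hr p)).X n) :=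
    .of_iso (CochainComplex.biproductXIso _ n).symm biproduct.projective
  flat_of_projective _

end

section

variable (M : ModuleCat.{u} R) {S : ShortComplex (ModuleCat.{u} R)} (p q n : ℤ)
  (hr : (ComplexShape.up ℤ).Rel (q - 1) q)

theorem isZero_homology_single_tensor_double (h : p + q ≠ n) (h' : p + q ≠ n + 1) :
    IsZero ((mapBifunctor ((single (ModuleCat.{u} R) (.up ℤ) p).obj M) (double S.f hr)
      (curriedTensor (ModuleCat.{u} R)) (.up ℤ)).homology n) :=
  (isZero_homology_map_double hr ((curriedTensor (ModuleCat.{u} R)).obj M) S.f (n - p)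
    (by lia) (by lia)).of_iso (singleMapBifunctorHomologyIso _ p M _ (n - p) n (by lia))

theorem nonempty_homology_single_tensor_double_iso_tensor (hS : S.ShortExact) (h : p + q = n) :
    Nonempty ((mapBifunctor ((single (ModuleCat.{u} R) (.up ℤ) p).obj M) (double S.f hr)
      (curriedTensor (ModuleCat.{u} R)) (.up ℤ)).homology n ≅ M ⊗ S.X₃) := by
  obtain ⟨e⟩ := hS.nonempty_cokernel_map_iso (tensorLeft M)
  exact ⟨singleMapBifunctorHomologyIso _ p M _ q n (by lia) ≪≫
    homologyMapDoubleIso₁ hr ((curriedTensor (ModuleCat.{u} R)).obj M) S.f (by lia) ≪≫ e⟩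

theorem nonempty_homology_single_tensor_double_iso_tor (hS : S.ShortExact) [Projective S.X₁]
    [Projective S.X₂] (h : p + q = n + 1) :
    Nonempty ((mapBifunctor ((single (ModuleCat.{u} R) (.up ℤ) p).obj M) (double S.f hr)
      (curriedTensor (ModuleCat.{u} R)) (.up ℤ)).homology n ≅
        ((Tor (ModuleCat.{u} R) 1).obj M).obj S.X₃) :=
  ⟨singleMapBifunctorHomologyIso _ p M _ (q - 1) n (by lia) ≪≫
    homologyMapDoubleIso₀ hr ((curriedTensor (ModuleCat.{u} R)).obj M) S.f (by lia) ≪≫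
    (hS.leftDerivedOneIso ((tensoringLeft (ModuleCat.{u} R)).obj M)).symm⟩

end

theorem nonempty_homology_tensor_iso_of_shortComplexes
    {S T : ℤ → ShortComplex (ModuleCat.{u} R)} (hT : ∀ q, (T q).ShortExact)
    (hT₁ : ∀ q, Projective (T q).X₁) (hT₂ : ∀ q, Projective (T q).X₂) (s t : Finset ℤ) (n : ℤ)
    (hr : ∀ p : ℤ, (ComplexShape.up ℤ).Rel (p - 1) p)
    (hst : ∀ p ∈ s, n - p ∈ t ∧ n + 1 - p ∈ t) :
    Nonempty ((mapBifunctor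
      (⨁ fun p : s ↦ (single (ModuleCat.{u} R) (.up ℤ) (p : ℤ)).obj (S p).X₃)
      (⨁ fun q : t ↦ double (T q).f (hr q))
      (curriedTensor (ModuleCat.{u} R)) (.up ℤ)).homology n ≅
        ⨁ fun p : s ↦ ((S p).X₃ ⊗ (T (n - p)).X₃) ⊞
          ((Tor (ModuleCat.{u} R) 1).obj (S p).X₃).obj (T (n + 1 - p)).X₃) := by
  refine ⟨mapBifunctorBiproductHomologyIso _ _ _ n ≪≫ biproduct.mapIso fun p ↦
    biproduct.isoBiprod (⟨n - p, (hst p p.2).1⟩ : t) ⟨n + 1 - p, (hst p p.2).2⟩ ?_ ?_ ≪≫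
      biprod.mapIso (Nonempty.some ?_) (Nonempty.some ?_)⟩
  · simp
  · intro q h h'
    refine isZero_homology_single_tensor_double _ _ _ _ _ (fun hq ↦ h ?_) fun hq ↦ h' ?_
    · ext
      dsimp
      lia
    · ext
      dsimp
      lia
  · exact nonempty_homology_single_tensor_double_iso_tensor _ _ _ _ _ (hT _) (by simp)
  · have := hT₁ (n + 1 - p)
    have := hT₂ (n + 1 - p)
    exact nonempty_homology_single_tensor_double_iso_tor _ _ _ _ _ (hT _) (by simp)

theorem isZero_tor_obj_of_isZero {M : ModuleCat.{u} R} (hM : IsZero M) (n : ℕ)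
    (N : ModuleCat.{u} R) : IsZero (((Tor (ModuleCat.{u} R) n).obj M).obj N) := by
  let P := ProjectiveResolution.of N
  let G := (tensoringLeft (ModuleCat.{u} R)).obj M
  have hz : IsZero (((G.mapHomologicalComplex _).obj P.complex).homology n) :=
    (exactAt_iff_isZero_homology _ _).1 <| ShortComplex.exact_of_isZero_X₂ _
      ((tensorRight (P.complex.X n)).map_isZero hM)
  exact hz.of_iso (P.isoLeftDerivedObj G n)

/-- A biproduct of binary biproducts of modules is a binary product of direct sums. -/
theorem nonempty_biproduct_biprod_iso (U V : ℤ → ModuleCat.{u} R) (s : Finset ℤ)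
    (hU : ∀ i ∉ s, IsZero (U i)) (hV : ∀ i ∉ s, IsZero (V i)) :
    Nonempty ((⨁ fun i : s ↦ U i ⊞ V i) ≅
      ModuleCat.of R ((DirectSum ℤ fun i ↦ U i) × (DirectSum ℤ fun i ↦ V i))) :=
  ⟨biproduct.mapIso (fun i : s ↦ biprodIsoProd (U i) (V i)) ≪≫ biproductIsoPi _ ≪≫
    (DirectSum.piProdLinearEquiv (R := R) (fun i ↦ U i) (fun i ↦ V i) s
      (fun i hi ↦ subsingleton_of_isZero (hU i hi))
      fun i hi ↦ subsingleton_of_isZero (hV i hi)).toModuleIso⟩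

theorem nonempty_homology_tensor_iso [IsDomain R] [IsPrincipalIdealRing R]
    (A B : CochainComplex (ModuleCat.{u} R) ℤ) (a b : ℤ)
    (hA : ∀ n : ℤ, n < a ∨ b < n → IsZero (A.X n))
    (hB : ∀ n : ℤ, n < a ∨ b < n → IsZero (B.X n))
    (hflat : ∀ q : ℤ, Module.Flat R (B.X q)) (i : ℤ) :
    Nonempty ((mapBifunctor A B (curriedTensor (ModuleCat.{u} R)) (.up ℤ)).homology i ≅
      ⨁ fun p : Finset.Icc a b ↦ (A.homology p ⊗ B.homology (i - p)) ⊞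
        ((Tor (ModuleCat.{u} R) 1).obj (A.homology p)).obj (B.homology (i + 1 - p))) := by
  have hr (p : ℤ) : (ComplexShape.up ℤ).Rel (p - 1) p := by simp
  obtain ⟨S, hS, hS₁, hS₂, eS, φ, hφ⟩ := CochainComplex.exists_quasiIso_biproduct_double
    (fun i ↦ projective_of_mono i) A (Finset.Icc a b)
    (fun n hn ↦ hA n (by simp at hn; lia)) hr
  let c := min a (i - b)
  let d := max b (i + 1 - a)
  obtain ⟨T, hT, hT₁, hT₂, eT, ψ, hψ⟩ := CochainComplex.exists_quasiIso_biproduct_double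
    (fun i ↦ projective_of_mono i) B (Finset.Icc c d)
    (fun n hn ↦ hB n (by simp at hn; lia)) hr
  let σ : (⨁ fun p : Finset.Icc a b ↦ double (S p).f (hr p)) ⟶
      ⨁ fun p : Finset.Icc a b ↦ (single (ModuleCat.{u} R) (.up ℤ) (p : ℤ)).obj (S p).X₃ :=
    biproduct.map fun p ↦ doubleToSingle (hr p) (by lia) (S p).f (S p).g (S p).zero
  have hσ : QuasiIso σ :=
    have (p : Finset.Icc a b) :
        QuasiIso (doubleToSingle (hr p) (by lia) (S p).f (S p).g (S p).zero) :=
      quasiIso_doubleToSingle _ _ (hS p)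
    quasiIso_biproduct_map _
  have h₁ := quasiIso_mapBifunctorMap_left_of_flat φ B a b hB hflat
  have h₂ := quasiIso_mapBifunctorMap_right_of_flat _ ψ (a - 1) b
    (isZero_biproduct_double_X (S := S) (Finset.Icc a b) hr a b (fun p hp ↦ by simpa using hp))
    (flat_biproduct_double_X _ _ hS₁ hS₂)
  have h₃ := quasiIso_mapBifunctorMap_left_of_flat σ _ (c - 1) d
    (isZero_biproduct_double_X (S := T) (Finset.Icc c d) hr c d (fun p hp ↦ by simpa using hp))
    (flat_biproduct_double_X _ _ hT₁ hT₂)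
  obtain ⟨e⟩ := nonempty_homology_tensor_iso_of_shortComplexes (S := S) hT hT₁ hT₂
    (Finset.Icc a b) (Finset.Icc c d) i hr (fun p hp ↦ by simp at hp ⊢; lia)
  have eU (p : ℤ) := ((eS p).some ⊗ᵢ (eT (i - p)).some)
  have eV (p : ℤ) : ((Tor (ModuleCat.{u} R) 1).obj (S p).X₃).obj (T (i + 1 - p)).X₃ ≅
      ((Tor (ModuleCat.{u} R) 1).obj (A.homology p)).obj (B.homology (i + 1 - p)) :=
    ((Tor (ModuleCat.{u} R) 1).mapIso (eS p).some).app _ ≪≫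
      ((Tor (ModuleCat.{u} R) 1).obj _).mapIso (eT _).some
  let F := curriedTensor (ModuleCat.{u} R)
  exact ⟨(isoOfQuasiIsoAt (mapBifunctorMap φ (𝟙 B) F (.up ℤ)) i).symm ≪≫
    (isoOfQuasiIsoAt (mapBifunctorMap (𝟙 _) ψ F (.up ℤ)) i).symm ≪≫
    isoOfQuasiIsoAt (mapBifunctorMap σ (𝟙 _) F (.up ℤ)) i ≪≫ e ≪≫
    biproduct.mapIso fun p ↦ biprod.mapIso (eU p) (eV p)⟩

end ModuleCat

end FiniteBiproducts

theorem kunneth_formula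
    (R : Type u) [CommRing R] [IsDomain R] [IsPrincipalIdealRing R]
    (A B : CochainComplex (ModuleCat.{u} R) ℤ) (a b : ℤ)
    (hA : ∀ n : ℤ, n < a ∨ b < n → IsZero (A.X n))
    (hB : ∀ n : ℤ, n < a ∨ b < n → IsZero (B.X n))
    (hflat : ∀ q : ℤ, Module.Flat R (B.X q)) (i : ℤ) :
    Nonempty ((HomologicalComplex.tensorObj A B).homology i ≅
      ModuleCat.of R
        ((DirectSum ℤ fun p => TensorProduct R (A.homology p) (B.homology (i - p))) ×
         (DirectSum ℤ fun r =>
           (((Tor (ModuleCat.{u} R) 1).obj (A.homology r)).obj (B.homology (i + 1 - r)))))) := by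
  have hz (n) (hn : n ∉ Finset.Icc a b) : IsZero (A.homology n) :=
    (HomologicalComplex.exactAt_iff_isZero_homology _ _).1 <|
      ShortComplex.exact_of_isZero_X₂ _ <| hA n (by simp at hn; lia)
  obtain ⟨e⟩ := ModuleCat.nonempty_homology_tensor_iso A B a b hA hB hflat i
  obtain ⟨e'⟩ := ModuleCat.nonempty_biproduct_biprod_iso
    (fun p ↦ A.homology p ⊗ B.homology (i - p))
    (fun p ↦ ((Tor (ModuleCat.{u} R) 1).obj (A.homology p)).obj (B.homology (i + 1 - p)))
    (Finset.Icc a b) (fun p hp ↦ (tensorRight _).map_isZero (hz p hp))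
    (fun p hp ↦ ModuleCat.isZero_tor_obj_of_isZero (hz p hp) 1 _)
  exact ⟨e ≪≫ e'⟩
end
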